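/- Let M, H > 0 with H ≥ M, and let x_1, …, x_n ∈ [−M, M] be real numbers; set x_{n+1} = H. Then the sample variance of (x_1, …, x_{n+1}) satisfies s²(x) ≥ (n/(n+1)²)(H − M)², and equality is attained when x_1 = ⋯ = x_n = M. -/

import Mathlib

/-- The sample variance of a tuple `y : Fin m → ℝ`:
`s²(y) = (1/m) ∑ i, (y i − ȳ)²` where `ȳ = (1/m) ∑ i, y i`. -/
noncomputable def sampleVar {m : ℕ} (y : Fin m → ℝ) : ℝ :=
  (∑ i, (y i - (∑ j, y j) / m) ^ 2) / m

theorem sampleVar_snoc_aux (n : ℕ) (H : ℝ) (x : Fin n → ℝ) :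
    sampleVar (Fin.snoc x H : Fin (n + 1) → ℝ) =
      ((n * ∑ i, x i ^ 2 - (∑ i, x i) ^ 2) + ∑ i, (H - x i) ^ 2) / ((n : ℝ) + 1) ^ 2 := by
  have hn : (n : ℝ) + 1 ≠ 0 := by positivity
  unfold sampleVar
  simp only [Fin.sum_univ_castSucc, Fin.snoc_castSucc, Fin.snoc_last, sub_sq,
    Finset.sum_add_distrib, Finset.sum_sub_distrib, ← Finset.mul_sum, ← Finset.sum_mul,
    Finset.sum_const, Finset.card_univ, Fintype.card_fin, nsmul_eq_mul]
  push_cast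
  field_simp
  ring

/-- Let `M, H > 0` with `H ≥ M`, let `x₁, …, xₙ ∈ [−M, M]` and set `x_{n+1} = H`.
Then the sample variance of `(x₁, …, x_{n+1})` satisfies
`s²(x) ≥ (n/(n+1)²)(H − M)²`, with equality when `x₁ = ⋯ = xₙ = M`. -/
theorem sampleVar_ge_of_outlier_min (n : ℕ) (M H : ℝ) (hM : 0 < M) (hH : 0 < H)
    (hHM : M ≤ H) (x : Fin n → ℝ) (hx : ∀ i, x i ∈ Set.Icc (-M) M) :
    ((n : ℝ) / ((n : ℝ) + 1) ^ 2) * (H - M) ^ 2 ≤ sampleVar (Fin.snoc x H) ∧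
      sampleVar (Fin.snoc (fun _ : Fin n => M) H) =
        ((n : ℝ) / ((n : ℝ) + 1) ^ 2) * (H - M) ^ 2 := by
  rw [sampleVar_snoc_aux, sampleVar_snoc_aux, div_mul_eq_mul_div]
  constructor
  · gcongr
    have h1 : (∑ i, x i) ^ 2 ≤ n * ∑ i, x i ^ 2 := by
      simpa using sq_sum_le_card_mul_sum_sq (s := Finset.univ) (f := x)
    have h2 : (n : ℝ) * (H - M) ^ 2 ≤ ∑ i, (H - x i) ^ 2 := by
      have : ∑ _i : Fin n, (H - M) ^ 2 ≤ ∑ i, (H - x i) ^ 2 := by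
        apply Finset.sum_le_sum
        intro i _
        have := (hx i).2
        exact pow_le_pow_left₀ (by linarith) (by linarith) 2
      simpa using this
    linarith
  · congr 1
    simp
    ring
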